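/- Let (μ_n)_{n ≥ 1} be a sequence of Borel probability measures on ℝ such that sup_n ∫ x² dμ_n(x) < ∞, and suppose that for every real λ, ∫ (iλ − x) e^{iλx} dμ_n(x) → 0 as n → ∞ (an integral of a complex-valued function, with i the imaginary unit). Then μ_n converges weakly to the standard Gaussian measure N(0,1) on ℝ. -/

import Mathlib

open MeasureTheory ProbabilityTheory Filter
open scoped ENNReal

lemma stein_aux_int (ν : Measure ℝ) [IsProbabilityMeasure ν] (M : ℝ≥0∞) (hM : M < ⊤)
    (h : ∫⁻ x, ENNReal.ofReal (x ^ 2) ∂ν ≤ M) :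
    Integrable (fun x : ℝ => |x|) ν ∧ ∫ x, |x| ∂ν ≤ 1 + M.toReal := by
  have h2 : Integrable (fun x : ℝ => x ^ 2) ν := by
    refine ⟨by fun_prop, ?_⟩
    rw [hasFiniteIntegral_iff_ofReal (Eventually.of_forall fun x => sq_nonneg x)]
    exact h.trans_lt hM
  have hb : ∀ x : ℝ, |x| ≤ 1 + x ^ 2 := fun x => by
    nlinarith [sq_nonneg (|x| - 1), sq_abs x, abs_nonneg x]
  have hi : Integrable (fun x : ℝ => 1 + x ^ 2) ν := (integrable_const _).add h2
  have h1 : Integrable (fun x : ℝ => |x|) ν :=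
    hi.mono' (by fun_prop) (Eventually.of_forall fun x => by simpa using hb x)
  refine ⟨h1, ?_⟩
  calc ∫ x, |x| ∂ν ≤ ∫ x, (1 + x ^ 2) ∂ν := integral_mono h1 hi hb
    _ = 1 + ∫ x, x ^ 2 ∂ν := by
      rw [integral_add (integrable_const _) h2]; simp
    _ ≤ 1 + M.toReal := by
      gcongr
      rw [integral_eq_lintegral_of_nonneg_ae (Eventually.of_forall fun x => sq_nonneg x)
        (by fun_prop)]
      exact ENNReal.toReal_mono hM.ne h

lemma stein_aux_norm (t x : ℝ) : ‖Complex.exp ((t : ℂ) * Complex.I * (x : ℂ))‖ = 1 := by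
  rw [show (t : ℂ) * Complex.I * (x : ℂ) = ((t * x : ℝ) : ℂ) * Complex.I by push_cast; ring]
  exact Complex.norm_exp_ofReal_mul_I _

lemma stein_aux_bound (t x : ℝ) : ‖((t : ℂ) * Complex.I - (x : ℂ)) *
    Complex.exp ((t : ℂ) * Complex.I * (x : ℂ))‖ ≤ |t| + |x| := by
  rw [norm_mul, stein_aux_norm, mul_one]
  refine (norm_sub_le _ _).trans ?_
  simp

lemma stein_aux_ftc (ν : Measure ℝ) [IsProbabilityMeasure ν]
    (h1 : Integrable (fun x : ℝ => |x|) ν) (t : ℝ) :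
    ∫ u in (0 : ℝ)..t, Complex.exp ((u : ℂ) ^ 2 / 2) * (-Complex.I *
      ∫ x, ((u : ℂ) * Complex.I - (x : ℂ)) * Complex.exp ((u : ℂ) * Complex.I * (x : ℂ)) ∂ν)
    = Complex.exp ((t : ℂ) ^ 2 / 2) * charFun ν t - 1 := by
  have hd : ∀ u : ℝ, HasDerivAt
      (fun u : ℝ => ∫ x, Complex.exp ((u : ℂ) * Complex.I * (x : ℂ)) ∂ν)
      (∫ x, (Complex.I * (x : ℂ)) * Complex.exp ((u : ℂ) * Complex.I * (x : ℂ)) ∂ν) u := by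
    intro u
    refine (hasDerivAt_integral_of_dominated_loc_of_deriv_le (bound := fun x => |x|)
      (F' := fun (u : ℝ) (x : ℝ) => (Complex.I * (x : ℂ)) *
        Complex.exp ((u : ℂ) * Complex.I * (x : ℂ)))
      (Metric.ball_mem_nhds u one_pos) ?_ ?_ ?_ ?_ h1 ?_).2
    · exact Eventually.of_forall fun v => Continuous.aestronglyMeasurable (by fun_prop)
    · refine (integrable_const (1 : ℝ)).mono' (Continuous.aestronglyMeasurable (by fun_prop)) ?_
      exact Eventually.of_forall fun x => (stein_aux_norm u x).le
    · exact Continuous.aestronglyMeasurable (by fun_prop)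
    · refine Eventually.of_forall fun x v _ => ?_
      rw [norm_mul, stein_aux_norm]; simp
    · refine Eventually.of_forall fun x v _ => ?_
      have h0 : HasDerivAt (fun v : ℝ => (v : ℂ)) 1 v := Complex.ofRealCLM.hasDerivAt
      convert! ((h0.mul_const Complex.I).mul_const (x : ℂ)).cexp using 1
      ring
  have hc : Continuous (fun u : ℝ => ∫ x, ((u : ℂ) * Complex.I - (x : ℂ)) *
      Complex.exp ((u : ℂ) * Complex.I * (x : ℂ)) ∂ν) := by
    rw [continuous_iff_continuousAt]
    intro u
    refine continuousAt_of_dominated (bound := fun x => (|u| + 1) + |x|) ?_ ?_ ?_ ?_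
    · exact Eventually.of_forall fun v => Continuous.aestronglyMeasurable (by fun_prop)
    · filter_upwards [Metric.ball_mem_nhds u one_pos] with v hv
      refine Eventually.of_forall fun x => (stein_aux_bound v x).trans ?_
      rw [Metric.mem_ball, Real.dist_eq] at hv
      have := abs_sub_abs_le_abs_sub v u
      linarith
    · exact (integrable_const _).add h1
    · exact Eventually.of_forall fun x => Continuous.continuousAt (by fun_prop)
  have hs : ∀ u : ℝ, -Complex.I *
      ∫ x, ((u : ℂ) * Complex.I - (x : ℂ)) * Complex.exp ((u : ℂ) * Complex.I * (x : ℂ)) ∂ν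
      = u * (∫ x, Complex.exp ((u : ℂ) * Complex.I * (x : ℂ)) ∂ν) +
      ∫ x, (Complex.I * (x : ℂ)) * Complex.exp ((u : ℂ) * Complex.I * (x : ℂ)) ∂ν := by
    intro u
    rw [← integral_const_mul, ← integral_const_mul, ← integral_add]
    · congr 1; ext x
      linear_combination (-(u : ℂ) * Complex.exp ((u : ℂ) * Complex.I * (x : ℂ))) * Complex.I_sq
    · refine Integrable.const_mul ?_ _
      refine (integrable_const (1 : ℝ)).mono' (Continuous.aestronglyMeasurable (by fun_prop)) ?_
      exact Eventually.of_forall fun x => (stein_aux_norm u x).le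
    · refine h1.mono' (Continuous.aestronglyMeasurable (by fun_prop)) ?_
      refine Eventually.of_forall fun x => ?_
      rw [norm_mul, stein_aux_norm]; simp
  have key := intervalIntegral.integral_eq_sub_of_hasDerivAt (a := 0) (b := t)
    (f := fun u : ℝ => Complex.exp ((u : ℂ) ^ 2 / 2) *
      ∫ x, Complex.exp ((u : ℂ) * Complex.I * (x : ℂ)) ∂ν)
    (f' := fun u : ℝ => Complex.exp ((u : ℂ) ^ 2 / 2) * (-Complex.I *
      ∫ x, ((u : ℂ) * Complex.I - (x : ℂ)) * Complex.exp ((u : ℂ) * Complex.I * (x : ℂ)) ∂ν))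
    (fun u _ => by
      have h0 : HasDerivAt (fun v : ℝ => (v : ℂ)) 1 u := Complex.ofRealCLM.hasDerivAt
      convert! (((h0.pow 2).div_const 2).cexp).mul (hd u) using 1
      rw [hs u]
      simp
      ring)
    (Continuous.intervalIntegrable (by fun_prop) _ _)
  rw [key, charFun_apply_real]
  simp only [mul_right_comm _ Complex.I]
  simp

/-- **Bolthausen's Stein-method CLT criterion.** Let `(μ_n)` be Borel probability measures
on `ℝ` with uniformly bounded second moments, such that for every `λ ∈ ℝ`,
`∫ (iλ − x) e^{iλx} dμ_n(x) → 0`. Then `μ_n` converges weakly to the standard Gaussian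
measure `N(0,1)`. -/
theorem stein_criterion_weak_convergence
    (μ : ℕ → Measure ℝ) (hprob : ∀ n, IsProbabilityMeasure (μ n))
    (hmom : ∃ M : ℝ≥0∞, M < ⊤ ∧ ∀ n, ∫⁻ x, ENNReal.ofReal (x ^ 2) ∂(μ n) ≤ M)
    (hstein : ∀ l : ℝ,
      Tendsto (fun n => ∫ x, ((l : ℂ) * Complex.I - (x : ℂ)) *
          Complex.exp ((l : ℂ) * Complex.I * (x : ℂ)) ∂(μ n)) atTop (nhds 0)) :
    ∀ f : BoundedContinuousFunction ℝ ℝ,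
      Tendsto (fun n => ∫ x, f x ∂(μ n)) atTop
        (nhds (∫ x, f x ∂(gaussianReal 0 1))) := by
  obtain ⟨M, hM, hmom⟩ := hmom
  have hI := fun n => stein_aux_int (μ n) M hM (hmom n)
  let P : ℕ → ProbabilityMeasure ℝ := fun n => ⟨μ n, hprob n⟩
  let G : ProbabilityMeasure ℝ := ⟨gaussianReal 0 1, inferInstance⟩
  suffices h : Tendsto P atTop (nhds G) from
    ProbabilityMeasure.tendsto_iff_forall_integral_tendsto.1 h
  refine ProbabilityMeasure.tendsto_iff_tendsto_charFun.2 fun t => ?_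
  change Tendsto (fun n => charFun (μ n) t) atTop (nhds (charFun (gaussianReal 0 1) t))
  have hlim : Tendsto (fun n => ∫ u in (0 : ℝ)..t, Complex.exp ((u : ℂ) ^ 2 / 2) * (-Complex.I *
      ∫ x, ((u : ℂ) * Complex.I - (x : ℂ)) *
        Complex.exp ((u : ℂ) * Complex.I * (x : ℂ)) ∂(μ n))) atTop
      (nhds (∫ u in (0 : ℝ)..t, (0 : ℂ))) := by
    refine intervalIntegral.tendsto_integral_filter_of_dominated_convergence
      (fun u => ‖Complex.exp ((u : ℂ) ^ 2 / 2)‖ * (|u| + (1 + M.toReal))) ?_ ?_ ?_ ?_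
    · refine Eventually.of_forall fun n => ?_
      refine AEStronglyMeasurable.mul (Continuous.aestronglyMeasurable (by fun_prop)) ?_
      refine AEStronglyMeasurable.const_mul ?_ _
      refine StronglyMeasurable.aestronglyMeasurable ?_
      refine StronglyMeasurable.integral_prod_right (f := fun (u x : ℝ) =>
        ((u : ℂ) * Complex.I - (x : ℂ)) * Complex.exp ((u : ℂ) * Complex.I * (x : ℂ))) ?_
      refine Continuous.stronglyMeasurable ?_
      simp only [Function.uncurry_def]
      fun_prop
    · refine Eventually.of_forall fun n => Eventually.of_forall fun u _ => ?_
      rw [norm_mul, norm_mul, norm_neg, Complex.norm_I, one_mul]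
      gcongr
      refine (norm_integral_le_of_norm_le ((integrable_const |u|).add (hI n).1)
        (Eventually.of_forall fun x => stein_aux_bound u x)).trans ?_
      simp only [Pi.add_apply]
      rw [integral_add (integrable_const _) (hI n).1]
      simpa using (hI n).2
    · exact Continuous.intervalIntegrable (by fun_prop) _ _
    · refine Eventually.of_forall fun u _ => ?_
      simpa using ((hstein u).const_mul (-Complex.I)).const_mul (Complex.exp ((u : ℂ) ^ 2 / 2))
  simp only [fun n => stein_aux_ftc (μ n) (hI n).1 t, intervalIntegral.integral_zero] at hlim
  have h3 := (hlim.add_const 1).const_mul (Complex.exp (-((t : ℂ) ^ 2 / 2)))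
  simp only [sub_add_cancel, ← mul_assoc, ← Complex.exp_add, neg_add_cancel, Complex.exp_zero,
    one_mul, zero_add, mul_one] at h3
  convert! h3 using 2
  rw [charFun_gaussianReal]
  simp
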